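/- Let R be a Hermitian positive semidefinite m×m Toeplitz matrix of rank r. Then there exist angular frequencies ω_1,…,ω_r ∈ [0, 2π) and positive weights p̃_1,…,p̃_r > 0 such that R = Σ_{k=1}^r p̃_k · a(ω_k) a(ω_k)^H, where a(ω) = (1, e^{jω}, …, e^{j(m−1)ω})^T. -/

import Mathlib

open Matrix ComplexOrder

open Module in
/-- A linear isometry of a finite-dimensional complex inner product space is semisimple. -/
theorem LinearIsometry.isSemisimple {E : Type*} [NormedAddCommGroup E] [InnerProductSpace ℂ E]
    [FiniteDimensional ℂ E] (U : E →ₗᵢ[ℂ] E) : End.IsSemisimple U.toLinearMap := by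
  rw [End.isSemisimple_iff]
  intro p hp
  refine ⟨pᗮ, fun y hy => ?_, p.isCompl_orthogonal⟩
  have hmap : p.map U.toLinearMap = p :=
    Submodule.eq_of_le_of_finrank_eq (Submodule.map_le_iff_le_comap.2 hp)
      (LinearEquiv.finrank_eq (Submodule.equivMapOfInjective U.toLinearMap U.injective p)).symm
  rw [Submodule.mem_comap, Submodule.mem_orthogonal]
  intro x hx
  rw [← hmap] at hx
  obtain ⟨z, hz, rfl⟩ := hx
  exact (U.inner_map_map z y).trans ((Submodule.mem_orthogonal p y).1 hy z hz)

/-- Eigenvectors of a linear isometry have unimodular eigenvalues. -/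
theorem LinearIsometry.norm_eigenvalue {E : Type*} [NormedAddCommGroup E] [InnerProductSpace ℂ E]
    (U : E →ₗᵢ[ℂ] E) {x : E} {μ : ℂ} (hx : U x = μ • x) (h0 : x ≠ 0) : ‖μ‖ = 1 := by
  have h := U.norm_map x
  rw [hx, norm_smul] at h
  exact mul_right_cancel₀ (norm_ne_zero_iff.2 h0) (h.trans (one_mul _).symm)

/-- Applying a linear isometry multiplies the coordinate along an eigenvector by the eigenvalue. -/
theorem LinearIsometry.inner_eigenvector_map {E : Type*} [NormedAddCommGroup E]
    [InnerProductSpace ℂ E] (U : E →ₗᵢ[ℂ] E) {x : E} {μ : ℂ} (hx : U x = μ • x) (y : E) :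
    inner ℂ x (U y) = μ * inner ℂ x y := by
  rcases eq_or_ne x 0 with rfl | h0
  · simp
  have h := U.inner_map_map x y
  rw [hx, inner_smul_left] at h
  rw [← h, ← mul_assoc, Complex.mul_conj, Complex.normSq_eq_norm_sq, U.norm_eigenvalue hx h0]
  simp

open Module in
/-- The spectral theorem for isometries of a finite-dimensional complex inner product space. -/
theorem LinearIsometry.exists_orthonormalBasis_eigenvectors {E : Type*} [NormedAddCommGroup E]
    [InnerProductSpace ℂ E] [FiniteDimensional ℂ E] {r : ℕ} (hr : finrank ℂ E = r)
    (U : E →ₗᵢ[ℂ] E) :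
    ∃ (b : OrthonormalBasis (Fin r) ℂ E) (μ : Fin r → ℂ), ∀ k, U (b k) = μ k • b k := by
  classical
  have hV : OrthogonalFamily ℂ (fun μ => End.eigenspace U.toLinearMap μ)
      fun μ => (End.eigenspace U.toLinearMap μ).subtypeₗᵢ := by
    refine OrthogonalFamily.of_pairwise fun ν μ hμν y hy x hx => ?_
    have hx : U x = μ • x := End.mem_eigenspace_iff.1 hx
    have hy : U y = ν • y := End.mem_eigenspace_iff.1 hy
    have h := U.inner_eigenvector_map hx y
    rw [hy, inner_smul_right] at h
    by_contra h0
    exact hμν (mul_right_cancel₀ h0 h)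
  have hint : DirectSum.IsInternal fun μ => End.eigenspace U.toLinearMap μ := by
    rw [hV.isInternal_iff, Submodule.orthogonal_eq_bot_iff,
      ← End.iSup_maxGenEigenspace_eq_top U.toLinearMap]
    exact iSup_congr fun μ =>
      (U.isSemisimple.isFinitelySemisimple.maxGenEigenspace_eq_eigenspace μ).symm
  have : Fintype {μ // End.eigenspace U.toLinearMap μ ≠ ⊥} :=
    (WellFoundedGT.finite_ne_bot_of_iSupIndep hint.submodule_iSupIndep).fintype
  have hint' := DirectSum.isInternal_ne_bot_iff.2 hint
  have hV' := hV.comp (Subtype.val_injective (p := fun μ => End.eigenspace U.toLinearMap μ ≠ ⊥))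
  refine ⟨hint'.subordinateOrthonormalBasis hr hV',
    fun k => (hint'.subordinateOrthonormalBasisIndex hr k hV').1, fun k => ?_⟩
  exact End.mem_eigenspace_iff.1 (hint'.subordinateOrthonormalBasis_subordinate hr k hV')

/-- Two finite families with the same Gram matrix are related by a linear isometry. -/
theorem exists_linearIsometry_of_inner_eq {E ι : Type*} [NormedAddCommGroup E]
    [InnerProductSpace ℂ E] [FiniteDimensional ℂ E] [Fintype ι] (v w : ι → E)
    (h : ∀ i j, inner ℂ (w i) (w j) = inner ℂ (v i) (v j)) :
    ∃ U : E →ₗᵢ[ℂ] E, ∀ i, U (v i) = w i := by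
  classical
  let S := Fintype.linearCombination ℂ v
  let T := Fintype.linearCombination ℂ w
  have hnorm : ∀ c, ‖T c‖ = ‖S c‖ := fun c => by
    have : inner ℂ (T c) (T c) = inner ℂ (S c) (S c) := by
      simp only [S, T, Fintype.linearCombination_apply, sum_inner, inner_sum, inner_smul_left,
        inner_smul_right, h]
    rw [@norm_eq_sqrt_re_inner ℂ, @norm_eq_sqrt_re_inner ℂ, this]
  obtain ⟨g, hg⟩ := S.rangeRestrict.exists_rightInverse_of_surjective S.range_rangeRestrict
  have hSg : ∀ x, S (g x) = x := fun x => congrArg Subtype.val (LinearMap.congr_fun hg x)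
  let L : S.range →ₗᵢ[ℂ] E := ⟨T ∘ₗ g, fun x => by
    rw [LinearMap.comp_apply, hnorm, hSg, Submodule.coe_norm]⟩
  refine ⟨L.extend, fun i => ?_⟩
  have hv : S (Pi.single i 1) = v i := by simp [S]
  have hw : T (Pi.single i 1) = w i := by simp [T]
  have hmem : v i ∈ S.range := ⟨_, hv⟩
  have hL : T (g ⟨v i, hmem⟩) = w i := by
    rw [← hw, ← sub_eq_zero, ← map_sub, ← norm_eq_zero, hnorm, map_sub, hSg, hv, sub_self,
      norm_zero]
  exact (L.extend_apply ⟨v i, hmem⟩).trans hL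

/-- A unimodular complex number is `exp (I * ω)` for some `ω ∈ [0, 2π)`. -/
theorem Complex.exists_exp_I_mul_eq_of_norm_eq_one {z : ℂ} (hz : ‖z‖ = 1) :
    ∃ ω : ℝ, (0 ≤ ω ∧ ω < 2 * Real.pi) ∧ Complex.exp (Complex.I * ω) = z := by
  have h : Complex.exp (Complex.I * z.arg) = z := by
    simpa [hz, mul_comm] using Complex.norm_mul_exp_arg_mul_I z
  rcases le_or_gt 0 z.arg with h0 | h0
  · exact ⟨z.arg, ⟨h0, by linarith [Complex.arg_le_pi z, Real.pi_pos]⟩, h⟩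
  · refine ⟨z.arg + 2 * Real.pi, ⟨by linarith [Complex.neg_pi_lt_arg z, Real.pi_pos],
      by linarith⟩, ?_⟩
    push_cast
    rw [mul_add, Complex.exp_add, mul_comm Complex.I (2 * _), Complex.exp_two_pi_mul_I, mul_one, h]

open Module in
/-- A spanning family whose Gram matrix is Toeplitz has a Gram matrix which is a positive
combination of powers of unimodular numbers. -/
theorem exists_inner_eq_sum_of_toeplitz {E : Type*} [NormedAddCommGroup E] [InnerProductSpace ℂ E]
    [FiniteDimensional ℂ E] {n r : ℕ} (hr : finrank ℂ E = r) (v : Fin (n + 1) → E)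
    (hspan : Submodule.span ℂ (Set.range v) = ⊤)
    (hv : ∀ i j : Fin n,
      inner ℂ (v i.succ) (v j.succ) = inner ℂ (v i.castSucc) (v j.castSucc)) :
    ∃ (μ : Fin r → ℂ) (p : Fin r → ℝ), (∀ k, ‖μ k‖ = 1) ∧ (∀ k, 0 < p k) ∧
      ∀ i j, inner ℂ (v i) (v j) =
        ∑ k, (p k : ℂ) * (star (μ k) ^ (i : ℕ) * μ k ^ (j : ℕ)) := by
  obtain ⟨U, hU⟩ :=
    exists_linearIsometry_of_inner_eq (fun i : Fin n => v i.castSucc) (fun i => v i.succ) hv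
  obtain ⟨b, μ, hb⟩ := U.exists_orthonormalBasis_eigenvectors hr
  have hcoord : ∀ k i, inner ℂ (b k) (v i) = μ k ^ (i : ℕ) * inner ℂ (b k) (v 0) := by
    intro k i
    induction i using Fin.induction with
    | zero => simp
    | succ i ih =>
      rw [← hU i, U.inner_eigenvector_map (hb k), ih, Fin.val_succ, pow_succ', mul_assoc]
      rfl
  refine ⟨μ, fun k => ‖inner ℂ (b k) (v 0)‖ ^ 2,
    fun k => U.norm_eigenvalue (hb k) (b.orthonormal.ne_zero k), fun k => ?_, fun i j => ?_⟩
  · refine pow_pos (norm_pos_iff.2 fun h0 => b.orthonormal.ne_zero k ?_) 2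
    have hle : Submodule.span ℂ (Set.range v) ≤ (Submodule.span ℂ {b k})ᗮ := by
      rw [Submodule.span_le]
      rintro _ ⟨i, rfl⟩
      exact Submodule.mem_orthogonal_singleton_iff_inner_right.2 (by rw [hcoord, h0, mul_zero])
    rw [hspan] at hle
    exact inner_self_eq_zero.1
      (Submodule.mem_orthogonal_singleton_iff_inner_right.1 (hle (Submodule.mem_top (x := b k))))
  · rw [← b.sum_inner_mul_inner]
    refine Finset.sum_congr rfl fun k _ => ?_
    rw [← inner_conj_symm (v i), hcoord k i, hcoord k j]
    push_cast
    rw [← Complex.mul_conj']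
    simp only [map_mul, map_pow, Complex.star_def]
    ring

open MatrixOrder in
/-- A positive semidefinite matrix is the Gram matrix of a spanning family in a space whose
dimension is the rank. -/
theorem Matrix.PosSemidef.exists_inner_eq {m : ℕ} {R : Matrix (Fin m) (Fin m) ℂ}
    (hR : R.PosSemidef) :
    ∃ (S : Submodule ℂ (EuclideanSpace ℂ (Fin m))) (v : Fin m → S),
      Module.finrank ℂ S = R.rank ∧ Submodule.span ℂ (Set.range v) = ⊤ ∧
      ∀ i j, R i j = inner ℂ (v i) (v j) := by
  obtain ⟨B, hB⟩ := CStarAlgebra.nonneg_iff_eq_star_mul_self.1 hR.nonneg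
  rw [Matrix.star_eq_conjTranspose] at hB
  let w : Fin m → EuclideanSpace ℂ (Fin m) := fun i => WithLp.toLp 2 (B.col i)
  refine ⟨Submodule.span ℂ (Set.range w), fun i => ⟨w i, Submodule.subset_span ⟨i, rfl⟩⟩,
    ?_, ?_, fun i j => ?_⟩
  · rw [hB, Matrix.rank_conjTranspose_mul_self, Matrix.rank_eq_finrank_span_cols]
    have : Submodule.span ℂ (Set.range w) = (Submodule.span ℂ (Set.range B.col)).map
        (WithLp.linearEquiv 2 ℂ (Fin m → ℂ)).symm.toLinearMap := by
      rw [Submodule.map_span, ← Set.range_comp]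
      rfl
    rw [this]
    exact LinearEquiv.finrank_map_eq _ _
  · refine Submodule.map_injective_of_injective (Submodule.subtype_injective _) ?_
    rw [Submodule.map_span, ← Set.range_comp, Submodule.map_top, Submodule.range_subtype]
    rfl
  · rw [hB]
    simp [w, Matrix.mul_apply, PiLp.inner_apply, mul_comm]

/-- Caratheodory–Fejér parametrization: a PSD Hermitian Toeplitz matrix of
rank `r` is a positive combination of `r` steering-vector dyads. -/
theorem stmt16 {m r : ℕ} (R : Matrix (Fin m) (Fin m) ℂ) (hR : R.PosSemidef)
    (hToep : ∀ i j k l : Fin m,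
      ((i : ℕ) : ℤ) - ((j : ℕ) : ℤ) = ((k : ℕ) : ℤ) - ((l : ℕ) : ℤ) →
      R i j = R k l)
    (hrank : R.rank = r) :
    ∃ (ω : Fin r → ℝ) (p : Fin r → ℝ),
      (∀ k, 0 ≤ ω k ∧ ω k < 2 * Real.pi) ∧ (∀ k, 0 < p k) ∧
      R = ∑ k : Fin r, p k •
        Matrix.vecMulVec
          (fun i : Fin m => Complex.exp (Complex.I * (ω k : ℂ) * ((i : ℕ) : ℂ)))
          (star fun i : Fin m =>
            Complex.exp (Complex.I * (ω k : ℂ) * ((i : ℕ) : ℂ))) := by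
  obtain _ | n := m
  · exact ⟨fun _ => 0, fun _ => 1, fun _ => ⟨le_rfl, by positivity⟩, fun _ => one_pos,
      Matrix.ext fun i => i.elim0⟩
  obtain ⟨S, v, hS, hspan, hv⟩ := hR.exists_inner_eq
  obtain ⟨μ, p, hμ, hp, hsum⟩ := exists_inner_eq_sum_of_toeplitz (hS.trans hrank) v hspan
    fun i j => by
      rw [← hv, ← hv]
      exact hToep _ _ _ _ (by simp)
  choose ω hω hexp using fun k =>
    Complex.exists_exp_I_mul_eq_of_norm_eq_one ((norm_star (μ k)).trans (hμ k))
  refine ⟨ω, p, hω, hp, Matrix.ext fun i j => ?_⟩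
  have hpow : ∀ k (i : ℕ), Complex.exp (Complex.I * ω k * i) = star (μ k) ^ i := fun k i => by
    rw [mul_comm, Complex.exp_nat_mul, hexp]
  rw [hv, hsum, Matrix.sum_apply]
  simp [hpow, Matrix.vecMulVec_apply]
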